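/- Let t < T be real numbers, Δ = T − t, and let {φ_j} be the shifted Legendre system on [t, T]. For j₁, j₂, j₃ ∈ ℕ define C_{j₃j₂j₁} = ∫_t^T φ_{j₃}(z) ∫_t^z φ_{j₂}(y) ∫_t^y φ_{j₁}(x) dx dy dz. Then for every j₃ ∈ ℕ, the series Σ_{j₁=0}^∞ C_{j₃j₁j₁} converges and equals (1/2)·∫_t^T (z − t) φ_{j₃}(z) dz. -/

import Mathlib

/-- The Legendre polynomial via the Rodrigues formula. -/
noncomputable def legendreP (n : ℕ) (x : ℝ) : ℝ :=
  (1 / (2 ^ n * (Nat.factorial n : ℝ))) *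
    iteratedDeriv n (fun y : ℝ => (y ^ 2 - 1) ^ n) x

/-- The shifted Legendre system on `[t, T]`. -/
noncomputable def shiftedLegendre (t T : ℝ) (j : ℕ) (x : ℝ) : ℝ :=
  Real.sqrt ((2 * (j : ℝ) + 1) / (T - t)) *
    legendreP j ((x - t - (T - t) / 2) * (2 / (T - t)))

/-- Triple Fourier–Legendre coefficient
`C_{j₃j₂j₁} = ∫_t^T φ_{j₃}(z) ∫_t^z φ_{j₂}(y) ∫_t^y φ_{j₁}(x) dx dy dz`. -/
noncomputable def tripleCoeff (t T : ℝ) (j₃ j₂ j₁ : ℕ) : ℝ :=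
  ∫ z in t..T, shiftedLegendre t T j₃ z *
    ∫ y in t..z, shiftedLegendre t T j₂ y *
      ∫ x in t..y, shiftedLegendre t T j₁ x

open MeasureTheory Set
open scoped Polynomial

section Rodrigues

open Polynomial in
/-- The unnormalised Legendre polynomial `(d/dX)ⁿ (X² - 1)ⁿ`. -/
noncomputable def rodriguesPoly (n : ℕ) : ℝ[X] :=
  derivative^[n] ((X ^ 2 - 1) ^ n)

theorem iteratedDeriv_polynomial_eval (p : ℝ[X]) (n : ℕ) :
    iteratedDeriv n (fun x => p.eval x) = fun x => (Polynomial.derivative^[n] p).eval x := by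
  induction n with
  | zero => simp
  | succ n ih =>
    rw [iteratedDeriv_succ, ih, Function.iterate_succ_apply']
    ext x
    exact Polynomial.deriv _

theorem legendreP_eq_eval (n : ℕ) (x : ℝ) :
    legendreP n x = 1 / (2 ^ n * (n.factorial : ℝ)) * (rodriguesPoly n).eval x := by
  have h := congrFun (iteratedDeriv_polynomial_eval ((Polynomial.X ^ 2 - 1) ^ n) n) x
  simp only [Polynomial.eval_pow, Polynomial.eval_sub, Polynomial.eval_X, Polynomial.eval_one] at h
  rw [legendreP, h, rodriguesPoly]

theorem integral_iterate_derivative_mul (p : ℝ[X]) (a b : ℝ) (k : ℕ)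
    (ha : ∀ i < k, (Polynomial.derivative^[i] p).eval a = 0)
    (hb : ∀ i < k, (Polynomial.derivative^[i] p).eval b = 0) (q : ℝ[X]) :
    ∫ x in a..b, (Polynomial.derivative^[k] p).eval x * q.eval x =
      (-1) ^ k * ∫ x in a..b, p.eval x * (Polynomial.derivative^[k] q).eval x := by
  induction k generalizing q with
  | zero => simp
  | succ k ih =>
    have hparts := intervalIntegral.integral_deriv_mul_eq_sub
      (a := a) (b := b)
      (fun x _ => (Polynomial.derivative^[k] p).hasDerivAt x) (fun x _ => q.hasDerivAt x)
      ((Polynomial.continuous _).intervalIntegrable _ _)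
      ((Polynomial.continuous _).intervalIntegrable _ _)
    rw [ha k k.lt_succ_self, hb k k.lt_succ_self, intervalIntegral.integral_add
      (Continuous.intervalIntegrable (by fun_prop) _ _)
      (Continuous.intervalIntegrable (by fun_prop) _ _),
      ih (fun i hi => ha i (hi.trans k.lt_succ_self))
        (fun i hi => hb i (hi.trans k.lt_succ_self))] at hparts
    rw [Function.iterate_succ_apply', Function.iterate_succ_apply _ k q]
    linear_combination hparts

theorem monic_sq_sub_one_pow (n : ℕ) : ((Polynomial.X ^ 2 - 1 : ℝ[X]) ^ n).Monic :=
  (Polynomial.monic_X_pow_sub_C (1 : ℝ) two_ne_zero).pow n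

theorem natDegree_sq_sub_one_pow (n : ℕ) :
    ((Polynomial.X ^ 2 - 1 : ℝ[X]) ^ n).natDegree = 2 * n := by
  rw [Polynomial.natDegree_pow, ← Polynomial.C_1, Polynomial.natDegree_X_pow_sub_C, mul_comm]

theorem coeff_sq_sub_one_pow (n : ℕ) :
    ((Polynomial.X ^ 2 - 1 : ℝ[X]) ^ n).coeff (2 * n) = 1 := by
  rw [← natDegree_sq_sub_one_pow n]
  exact (monic_sq_sub_one_pow n).coeff_natDegree

theorem eval_iterate_derivative_sq_sub_one_pow {n k : ℕ} (hk : k < n) {a : ℝ} (ha : a ^ 2 = 1) :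
    (Polynomial.derivative^[k] ((Polynomial.X ^ 2 - 1 : ℝ[X]) ^ n)).eval a = 0 := by
  refine Polynomial.eval_eq_zero_of_dvd_of_eval_eq_zero
    (Polynomial.pow_sub_dvd_iterate_derivative_pow _ n k) ?_
  simp [ha, (Nat.sub_pos_of_lt hk).ne']

theorem natDegree_rodriguesPoly (n : ℕ) : (rodriguesPoly n).natDegree = n := by
  refine le_antisymm ?_ (Polynomial.le_natDegree_of_ne_zero ?_)
  · refine (Polynomial.natDegree_iterate_derivative _ _).trans ?_
    rw [natDegree_sq_sub_one_pow]
    lia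
  · rw [rodriguesPoly, Polynomial.coeff_iterate_derivative, ← two_mul, coeff_sq_sub_one_pow]
    simp [Nat.descFactorial_eq_zero_iff_lt]
    lia

theorem rodriguesPoly_ne_zero (n : ℕ) : rodriguesPoly n ≠ 0 := by
  intro h0
  have : (rodriguesPoly n).coeff n = 0 := by simp [h0]
  rw [rodriguesPoly, Polynomial.coeff_iterate_derivative, ← two_mul, coeff_sq_sub_one_pow] at this
  simp [Nat.descFactorial_eq_zero_iff_lt] at this
  lia

theorem iterate_derivative_rodriguesPoly (n : ℕ) :
    Polynomial.derivative^[n] (rodriguesPoly n) = Polynomial.C ((2 * n).factorial : ℝ) := by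
  rw [rodriguesPoly, ← Function.iterate_add_apply, ← two_mul]
  ext m
  rw [Polynomial.coeff_iterate_derivative, Polynomial.coeff_C]
  split_ifs with hm
  · simp [hm, coeff_sq_sub_one_pow, Nat.descFactorial_self]
  · rw [Polynomial.coeff_eq_zero_of_natDegree_lt, smul_zero]
    rw [natDegree_sq_sub_one_pow]
    lia

theorem integral_rodriguesPoly_mul (n : ℕ) (q : ℝ[X]) :
    ∫ x in (-1)..1, (rodriguesPoly n).eval x * q.eval x =
      ∫ x in (-1)..1, (1 - x ^ 2) ^ n * (Polynomial.derivative^[n] q).eval x := by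
  rw [rodriguesPoly, integral_iterate_derivative_mul _ _ _ _
    (fun i hi => eval_iterate_derivative_sq_sub_one_pow hi (by norm_num))
    (fun i hi => eval_iterate_derivative_sq_sub_one_pow hi (by norm_num)),
    ← intervalIntegral.integral_const_mul]
  congr 1 with x
  rw [← mul_assoc]
  simp [← mul_pow]

theorem integral_rodriguesPoly_mul_of_lt {m n : ℕ} (hmn : m < n) :
    ∫ x in (-1)..1, (rodriguesPoly n).eval x * (rodriguesPoly m).eval x = 0 := by
  rw [integral_rodriguesPoly_mul, Polynomial.iterate_derivative_eq_zero]
  · simp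
  · rwa [natDegree_rodriguesPoly]

theorem integral_one_sub_sq_pow_succ (n : ℕ) :
    (2 * n + 3 : ℝ) * ∫ x in (-1 : ℝ)..1, (1 - x ^ 2) ^ (n + 1) =
      (2 * n + 2 : ℝ) * ∫ x in (-1 : ℝ)..1, (1 - x ^ 2) ^ n := by
  have hderiv : ∀ x ∈ uIcc (-1 : ℝ) 1, HasDerivAt (fun y : ℝ => y * (1 - y ^ 2) ^ (n + 1))
      ((2 * n + 3) * (1 - x ^ 2) ^ (n + 1) - (2 * n + 2) * (1 - x ^ 2) ^ n) x := by
    intro x _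
    refine ((hasDerivAt_id x).mul ((((hasDerivAt_id x).pow 2).const_sub 1).pow (n + 1))).congr_deriv
      ?_
    simp
    ring
  have hint := intervalIntegral.integral_eq_sub_of_hasDerivAt hderiv
    (Continuous.intervalIntegrable (by fun_prop) _ _)
  rw [intervalIntegral.integral_sub (Continuous.intervalIntegrable (by fun_prop) _ _)
    (Continuous.intervalIntegrable (by fun_prop) _ _), intervalIntegral.integral_const_mul,
    intervalIntegral.integral_const_mul] at hint
  norm_num at hint
  linarith

theorem integral_one_sub_sq_pow (n : ℕ) :
    ((2 * n + 1).factorial : ℝ) * ∫ x in (-1 : ℝ)..1, (1 - x ^ 2) ^ n =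
      2 * (2 ^ n * n.factorial) ^ 2 := by
  induction n with
  | zero => simp; norm_num
  | succ n ih =>
    have hstep := integral_one_sub_sq_pow_succ n
    rw [show 2 * (n + 1) + 1 = 2 * n + 1 + 1 + 1 by ring, Nat.factorial_succ,
      Nat.factorial_succ (2 * n + 1), Nat.factorial_succ n]
    push_cast
    linear_combination (2 * n + 2) * ((2 * n + 1).factorial : ℝ) * hstep + (2 * n + 2) ^ 2 * ih

theorem integral_rodriguesPoly_sq (n : ℕ) :
    (2 * n + 1) * ∫ x in (-1)..1, (rodriguesPoly n).eval x * (rodriguesPoly n).eval x =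
      2 * (2 ^ n * n.factorial) ^ 2 := by
  rw [integral_rodriguesPoly_mul, iterate_derivative_rodriguesPoly, ← integral_one_sub_sq_pow,
    Nat.factorial_succ]
  simp only [Polynomial.eval_C, intervalIntegral.integral_mul_const]
  push_cast
  ring

theorem integral_legendreP_mul (m n : ℕ) :
    ∫ x in (-1)..1, legendreP m x * legendreP n x = if m = n then 2 / (2 * n + 1 : ℝ) else 0 := by
  have hfac : ∫ x in (-1)..1, legendreP m x * legendreP n x =
      1 / (2 ^ m * (m.factorial : ℝ)) * (1 / (2 ^ n * (n.factorial : ℝ))) *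
        ∫ x in (-1)..1, (rodriguesPoly m).eval x * (rodriguesPoly n).eval x := by
    rw [← intervalIntegral.integral_const_mul]
    congr 1 with x
    rw [legendreP_eq_eval, legendreP_eq_eval]
    ring
  rw [hfac]
  split_ifs with hmn
  · subst hmn
    have hsq := integral_rodriguesPoly_sq m
    rw [eq_div_iff (by positivity), mul_assoc, mul_comm (∫ _ in _.._, _), hsq]
    field_simp
  · rcases lt_or_gt_of_ne hmn with hlt | hlt
    · simp_rw [mul_comm ((rodriguesPoly m).eval _)]
      rw [integral_rodriguesPoly_mul_of_lt hlt, mul_zero]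
    · rw [integral_rodriguesPoly_mul_of_lt hlt, mul_zero]

end Rodrigues

section ShiftedLegendre

variable {t T : ℝ}

attribute [local instance] Measure.Subtype.measureSpace

/-- The shifted Legendre functions as polynomials. -/
noncomputable def shiftedLegendrePoly (t T : ℝ) (j : ℕ) : ℝ[X] :=
  Polynomial.C (Real.sqrt ((2 * (j : ℝ) + 1) / (T - t)) * (1 / (2 ^ j * (j.factorial : ℝ)))) *
    (rodriguesPoly j).comp (Polynomial.C (2 / (T - t)) * Polynomial.X +
      Polynomial.C (-(t + (T - t) / 2) * (2 / (T - t))))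

theorem eval_shiftedLegendrePoly (t T : ℝ) (j : ℕ) (x : ℝ) :
    (shiftedLegendrePoly t T j).eval x = shiftedLegendre t T j x := by
  rw [shiftedLegendre, legendreP_eq_eval, shiftedLegendrePoly]
  simp only [Polynomial.eval_mul, Polynomial.eval_C, Polynomial.eval_comp, Polynomial.eval_add,
    Polynomial.eval_X]
  rw [mul_assoc]
  congr 4
  ring

theorem continuous_shiftedLegendre (t T : ℝ) (j : ℕ) : Continuous (shiftedLegendre t T j) := by
  rw [← funext (eval_shiftedLegendrePoly t T j)]
  exact Polynomial.continuous _

theorem degree_shiftedLegendrePoly (h : t < T) (j : ℕ) :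
    (shiftedLegendrePoly t T j).degree = j := by
  have hΔ : 0 < T - t := sub_pos.2 h
  have hlin := Polynomial.natDegree_linear (b := -(t + (T - t) / 2) * (2 / (T - t)))
    (div_pos two_pos hΔ).ne'
  have hc : Real.sqrt ((2 * (j : ℝ) + 1) / (T - t)) * (1 / (2 ^ j * (j.factorial : ℝ))) ≠ 0 := by
    positivity
  rw [shiftedLegendrePoly, Polynomial.degree_C_mul hc, Polynomial.degree_eq_natDegree,
    Polynomial.natDegree_comp, hlin, natDegree_rodriguesPoly, mul_one]
  intro h0
  rcases Polynomial.comp_eq_zero_iff.1 h0 with h1 | h1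
  · exact rodriguesPoly_ne_zero j h1
  · rw [h1.2, Polynomial.natDegree_C] at hlin
    exact zero_ne_one hlin

theorem span_range_shiftedLegendrePoly (h : t < T) :
    Submodule.span ℝ (range (shiftedLegendrePoly t T)) = ⊤ := by
  let S : Polynomial.Sequence ℝ := ⟨shiftedLegendrePoly t T, degree_shiftedLegendrePoly h⟩
  exact S.span fun i => (Polynomial.leadingCoeff_ne_zero.2 (S.ne_zero i)).isUnit

theorem integral_shiftedLegendre_mul (h : t < T) (m n : ℕ) :
    ∫ x in t..T, shiftedLegendre t T m x * shiftedLegendre t T n x = if m = n then 1 else 0 := by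
  have hΔ : 0 < T - t := sub_pos.2 h
  have hsub := intervalIntegral.integral_comp_mul_sub (a := t) (b := T)
    (fun x => legendreP m x * legendreP n x) (div_pos two_pos hΔ).ne'
    ((t + (T - t) / 2) * (2 / (T - t)))
  have hl : 2 / (T - t) * t - (t + (T - t) / 2) * (2 / (T - t)) = -1 := by field_simp; ring
  have hr : 2 / (T - t) * T - (t + (T - t) / 2) * (2 / (T - t)) = 1 := by field_simp; ring
  rw [hl, hr, integral_legendreP_mul] at hsub
  have hfac : ∫ x in t..T, shiftedLegendre t T m x * shiftedLegendre t T n x =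
      Real.sqrt ((2 * (m : ℝ) + 1) / (T - t)) * Real.sqrt ((2 * (n : ℝ) + 1) / (T - t)) *
        ((2 / (T - t))⁻¹ • if m = n then 2 / (2 * n + 1 : ℝ) else 0) := by
    rw [← hsub, ← intervalIntegral.integral_const_mul]
    congr 1 with x
    rw [shiftedLegendre, shiftedLegendre, show (x - t - (T - t) / 2) * (2 / (T - t)) =
      2 / (T - t) * x - (t + (T - t) / 2) * (2 / (T - t)) by ring]
    ring
  rw [hfac]
  split_ifs with hmn
  · subst hmn
    rw [Real.mul_self_sqrt (by positivity), smul_eq_mul]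
    field_simp
  · simp

theorem isFiniteMeasure_volume_Icc (a b : ℝ) :
    IsFiniteMeasure (volume : Measure (Icc a b)) where
  measure_univ_lt_top := by
    rw [Measure.Subtype.volume_univ nullMeasurableSet_Icc, Real.volume_Icc]
    exact ENNReal.ofReal_lt_top

attribute [local instance] isFiniteMeasure_volume_Icc

/-- The shifted Legendre system as elements of `L²([t, T])`. -/
noncomputable def shiftedLegendreLp (t T : ℝ) (j : ℕ) :
    Lp ℝ 2 (volume : Measure (Icc t T)) :=
  ContinuousMap.toLp 2 volume ℝ ((shiftedLegendrePoly t T j).toContinuousMapOn (Icc t T))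

theorem coeFn_shiftedLegendreLp (t T : ℝ) (j : ℕ) :
    shiftedLegendreLp t T j =ᵐ[volume] fun x : Icc t T => shiftedLegendre t T j x := by
  filter_upwards [ContinuousMap.coeFn_toLp (p := 2) (𝕜 := ℝ) (volume : Measure (Icc t T))
    ((shiftedLegendrePoly t T j).toContinuousMapOn (Icc t T))] with x hx
  rw [← eval_shiftedLegendrePoly]
  exact hx

theorem integral_Icc_subtype (h : t ≤ T) (f : ℝ → ℝ) :
    ∫ x : Icc t T, f x = ∫ x in t..T, f x := by
  rw [integral_subtype measurableSet_Icc, integral_Icc_eq_integral_Ioc,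
    intervalIntegral.integral_of_le h]

theorem orthonormal_shiftedLegendreLp (h : t < T) : Orthonormal ℝ (shiftedLegendreLp t T) := by
  rw [orthonormal_iff_ite]
  intro i j
  rw [← integral_shiftedLegendre_mul h, ← integral_Icc_subtype h.le, L2.inner_def]
  refine integral_congr_ae ?_
  filter_upwards [coeFn_shiftedLegendreLp t T i, coeFn_shiftedLegendreLp t T j] with x hi hj
  rw [hi, hj]
  simp [mul_comm]

theorem span_shiftedLegendreLp_topologicalClosure (h : t < T) :
    (Submodule.span ℝ (range (shiftedLegendreLp t T))).topologicalClosure = ⊤ := by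
  have hspan : Submodule.span ℝ
      (range fun j => (shiftedLegendrePoly t T j).toContinuousMapOn (Icc t T)) =
        Subalgebra.toSubmodule (polynomialFunctions (Icc t T)) := by
    have := congrArg (Submodule.map (Polynomial.toContinuousMapOnAlgHom (Icc t T)).toLinearMap)
      (span_range_shiftedLegendrePoly h)
    rw [Submodule.map_span, ← range_comp] at this
    exact this
  have hclosure : (Submodule.span ℝ (range fun j =>
      (shiftedLegendrePoly t T j).toContinuousMapOn (Icc t T))).topologicalClosure = ⊤ := by
    rw [hspan]
    exact congrArg Subalgebra.toSubmodule (polynomialFunctions_closure_eq_top t T)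
  convert! (ContinuousMap.toLp_denseRange ℝ (volume : Measure (Icc t T)) ℝ
    ENNReal.ofNat_ne_top).topologicalClosure_map_submodule hclosure
  rw [Submodule.map_span, ← range_comp]
  rfl

theorem hasSum_sq_integral_shiftedLegendre (h : t < T) {z : ℝ} (hz : z ∈ Icc t T) :
    HasSum (fun j => (∫ x in t..z, shiftedLegendre t T j x) ^ 2) (z - t) := by
  have hs : MeasurableSet {x : Icc t T | (x : ℝ) ≤ z} :=
    measurableSet_le measurable_subtype_coe measurable_const
  let b := HilbertBasis.mk (orthonormal_shiftedLegendreLp h)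
    (span_shiftedLegendreLp_topologicalClosure h).ge
  let g := indicatorConstLp 2 hs (measure_ne_top volume _) (1 : ℝ)
  have hint (f : ℝ → ℝ) :
      ∫ x in {x : Icc t T | (x : ℝ) ≤ z}, f x = ∫ x in t..z, f x := by
    rw [← integral_indicator hs]
    change ∫ x : Icc t T, (Iic z).indicator f x = _
    rw [integral_Icc_subtype h.le, intervalIntegral.integral_of_le h.le,
      intervalIntegral.integral_of_le hz.1, setIntegral_indicator measurableSet_Iic,
      Ioc_inter_Iic, min_eq_right hz.2]
  have hcoeff (j : ℕ) : inner ℝ g (b j) = ∫ x in t..z, shiftedLegendre t T j x := by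
    rw [← hint, HilbertBasis.coe_mk, L2.inner_indicatorConstLp_one]
    exact integral_congr_ae (ae_restrict_of_ae (coeFn_shiftedLegendreLp t T j))
  have hnorm : inner ℝ g g = z - t := by
    have h1 := hint fun _ => 1
    rw [setIntegral_const, smul_eq_mul, mul_one, intervalIntegral.integral_const, smul_eq_mul,
      mul_one] at h1
    rw [L2.real_inner_indicatorConstLp_one_indicatorConstLp_one, inter_self, h1]
  rw [← hnorm]
  refine (b.hasSum_inner_mul_inner g g).congr_fun fun j => ?_
  rw [real_inner_comm g (b j), hcoeff, sq]

theorem integral_mul_primitive {f : ℝ → ℝ} (hf : Continuous f) (a b : ℝ) :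
    ∫ y in a..b, f y * ∫ x in a..y, f x = (∫ x in a..b, f x) ^ 2 / 2 := by
  have hderiv : ∀ y ∈ uIcc a b, HasDerivAt (fun z => (∫ x in a..z, f x) ^ 2 / 2)
      (f y * ∫ x in a..y, f x) y := fun y _ => by
    refine (((hf.integral_hasStrictDerivAt a y).hasDerivAt.pow 2).div_const 2).congr_deriv ?_
    simp
    ring
  have hcont : Continuous fun y => f y * ∫ x in a..y, f x :=
    hf.mul (intervalIntegral.continuous_primitive (fun _ _ => hf.intervalIntegrable _ _) a)
  rw [intervalIntegral.integral_eq_sub_of_hasDerivAt hderiv (hcont.intervalIntegrable _ _)]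
  simp

end ShiftedLegendre

/-- For every `j₃`, the series `Σ_{j₁=0}^∞ C_{j₃j₁j₁}` converges to
`(1/2)·∫_t^T (z − t) φ_{j₃}(z) dz`. -/
theorem tripleCoeff_diag_sum_first (t T : ℝ) (h : t < T) (j₃ : ℕ) :
    HasSum (fun j₁ : ℕ => tripleCoeff t T j₃ j₁ j₁)
      ((1 / 2) * ∫ z in t..T, (z - t) * shiftedLegendre t T j₃ z) := by
  have hcont := continuous_shiftedLegendre t T
  have hprim (j : ℕ) : Continuous fun z => ∫ x in t..z, shiftedLegendre t T j x :=
    intervalIntegral.continuous_primitive (fun _ _ => (hcont j).intervalIntegrable _ _) t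
  have hsum {z : ℝ} (hz : z ∈ Set.uIoc t T) :
      HasSum (fun j => (∫ x in t..z, shiftedLegendre t T j x) ^ 2 / 2) ((z - t) / 2) := by
    rw [Set.uIoc_of_le h.le] at hz
    exact (hasSum_sq_integral_shiftedLegendre h (Set.Ioc_subset_Icc_self hz)).div_const 2
  simp_rw [tripleCoeff, integral_mul_primitive (hcont _)]
  rw [← intervalIntegral.integral_const_mul]
  refine intervalIntegral.hasSum_integral_of_dominated_convergence
    (fun j z => |shiftedLegendre t T j₃ z| * ((∫ x in t..z, shiftedLegendre t T j x) ^ 2 / 2))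
    (fun j => ((hcont j₃).mul (((hprim j).pow 2).div_const 2)).aestronglyMeasurable)
    (fun j => .of_forall fun z _ => ?_)
    (.of_forall fun z hz => ((hsum hz).mul_left _).summable) ?_
    (.of_forall fun z hz => ?_)
  · rw [norm_mul, Real.norm_eq_abs, Real.norm_of_nonneg (by positivity)]
  · refine IntervalIntegrable.congr (f := fun z => |shiftedLegendre t T j₃ z| * ((z - t) / 2))
      (fun z hz => ((hsum hz).mul_left _).tsum_eq.symm) ?_
    exact ((hcont j₃).abs.mul (by fun_prop)).intervalIntegrable _ _
  · rw [show 1 / 2 * ((z - t) * shiftedLegendre t T j₃ z) =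
      shiftedLegendre t T j₃ z * ((z - t) / 2) by ring]
    exact (hsum hz).mul_left _
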